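/- (Corollary 4.7.) Fix 1 < p, s < ∞ and set q := s(p−1) + 1. If a weight w belongs to A_p ∩ RH_s, then w^s belongs to A_q with [w^s]_{A_q} ≤ ([w]_{A_p} · [w]_{RH_s})^s. Conversely, if w^s belongs to A_q, then w belongs to A_p ∩ RH_s with max{[w]_{A_p}, [w]_{RH_s}} ≤ [w^s]_{A_q}^{1/s}. -/

import Mathlib

open MeasureTheory

/-- The collection of open balls `B(x, ρ)` (with `ρ > 0`) such that the doubled ball
`B(x, 2ρ)` is contained in `Ω`. -/
def ballsIn {n : ℕ} (Ω : Set (EuclideanSpace ℝ (Fin n))) :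
    Set (Set (EuclideanSpace ℝ (Fin n))) :=
  {B | ∃ x ρ, 0 < ρ ∧ B = Metric.ball x ρ ∧ Metric.ball x (2 * ρ) ⊆ Ω}

/-- A weight on `Ω`: a measurable function that is positive a.e. on `Ω`. -/
def IsWeight {n : ℕ} (Ω : Set (EuclideanSpace ℝ (Fin n)))
    (w : EuclideanSpace ℝ (Fin n) → ℝ) : Prop :=
  Measurable w ∧ ∀ᵐ x ∂volume, x ∈ Ω → 0 < w x

/-- The `p`-mean of `w` over `B`, for an extended-real exponent `p`. -/
noncomputable def pMean {n : ℕ} (w : EuclideanSpace ℝ (Fin n) → ℝ) (p : EReal)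
    (B : Set (EuclideanSpace ℝ (Fin n))) : ℝ :=
  if p = ⊤ then essSup w (volume.restrict B)
  else if p = ⊥ then essInf w (volume.restrict B)
  else if p = 0 then Real.exp (⨍ x in B, Real.log (w x))
  else (⨍ x in B, (w x) ^ p.toReal) ^ (1 / p.toReal)

open Classical in
/-- Finiteness of the `p`-mean of `w` over `B`. -/
def MeanFinite {n : ℕ} (w : EuclideanSpace ℝ (Fin n) → ℝ) (p : EReal)
    (B : Set (EuclideanSpace ℝ (Fin n))) : Prop :=
  if p = ⊤ then ∃ M : ℝ, ∀ᵐ x ∂(volume.restrict B), w x ≤ M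
  else if p = ⊥ then ∃ m : ℝ, ∀ᵐ x ∂(volume.restrict B), m ≤ w x
  else if p = 0 then IntegrableOn (fun x => Real.log (w x)) B
  else IntegrableOn (fun x => (w x) ^ p.toReal) B

/-- `w ∈ RC(r, s, C)` over `Ω`: for every admissible ball the `r`- and `s`-means are finite
and `w(s,B) ≤ C · w(r,B)`. -/
def MemRC {n : ℕ} (Ω : Set (EuclideanSpace ℝ (Fin n)))
    (w : EuclideanSpace ℝ (Fin n) → ℝ) (r s : EReal) (C : ℝ) : Prop :=
  ∀ B ∈ ballsIn Ω, MeanFinite w r B ∧ MeanFinite w s B ∧ pMean w s B ≤ C * pMean w r B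

/-- `w ∈ RC(r,s) = ⋃_{C ≥ 1} RC(r,s,C)`. -/
def InRC {n : ℕ} (Ω : Set (EuclideanSpace ℝ (Fin n)))
    (w : EuclideanSpace ℝ (Fin n) → ℝ) (r s : EReal) : Prop :=
  ∃ C : ℝ, 1 ≤ C ∧ MemRC Ω w r s C

/-- `[w]_{RC(r,s)}`, the least admissible reversal constant. -/
noncomputable def RCconst {n : ℕ} (Ω : Set (EuclideanSpace ℝ (Fin n)))
    (w : EuclideanSpace ℝ (Fin n) → ℝ) (r s : EReal) : ℝ :=
  sInf {C : ℝ | 1 ≤ C ∧ MemRC Ω w r s C}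

lemma bern_aux {r x : ℝ} (hr : 1 ≤ r ∨ r < 0) (hx : 0 < x) : 1 + r * (x - 1) ≤ x ^ r := by
  rcases hr with hr | hr
  · have := one_add_mul_self_le_rpow_one_add (s := x - 1) (by linarith) hr
    simpa using this
  · have h1 := Real.log_le_sub_one_of_pos hx
    have h2 := Real.add_one_le_exp (Real.log x * r)
    rw [Real.rpow_def_of_pos hx]
    nlinarith

lemma int_pos_aux {α : Type*} [MeasurableSpace α] {P : Measure α} [IsProbabilityMeasure P]
    {f : α → ℝ} (hf : ∀ᵐ x ∂P, 0 < f x) (hi : Integrable f P) : 0 < ∫ x, f x ∂P := by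
  rw [integral_pos_iff_support_of_nonneg_ae (hf.mono fun x hx => hx.le) hi]
  have : P (Function.support f) = 1 := by
    rw [prob_compl_eq_zero_iff₀ (s := Function.support f) ?_ |>.symm]
    · refine measure_mono_null ?_ hf
      intro x hx
      simp only [Function.support, Set.mem_compl_iff, Set.mem_setOf_eq, not_not] at hx ⊢
      simp [hx]
    · exact hi.aestronglyMeasurable.aemeasurable.nullMeasurableSet_preimage
        (measurableSet_singleton (0:ℝ)).compl
  rw [this]; exact one_pos

lemma jensen_aux {α : Type*} [MeasurableSpace α] {P : Measure α} [IsProbabilityMeasure P]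
    {f : α → ℝ} {r : ℝ} (hr : 1 ≤ r ∨ r < 0) (hf : ∀ᵐ x ∂P, 0 < f x) (hi : Integrable f P)
    (hir : Integrable (fun x => f x ^ r) P) : (∫ x, f x ∂P) ^ r ≤ ∫ x, f x ^ r ∂P := by
  have hm := int_pos_aux hf hi
  set m := ∫ x, f x ∂P with hmdef
  have h0 : Integrable (fun x => r * (f x / m - 1)) P :=
    ((hi.div_const m).sub (integrable_const _)).const_mul r
  have h1 : Integrable (fun x => m ^ r * (1 + r * (f x / m - 1))) P :=
    Integrable.const_mul ((integrable_const _).add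
      (((hi.div_const m).sub (integrable_const _)).const_mul r)) _
  have h2 : ∫ x, m ^ r * (1 + r * (f x / m - 1)) ∂P = m ^ r := by
    rw [integral_const_mul, integral_add (integrable_const _) h0, integral_const_mul,
      integral_sub (hi.div_const m) (integrable_const _), integral_div, ← hmdef]
    simp [hm.ne']
  rw [← h2]
  refine integral_mono_ae h1 hir ?_
  filter_upwards [hf] with x hx
  have := bern_aux hr (div_pos hx hm)
  rw [Real.div_rpow hx.le hm.le, le_div_iff₀ (Real.rpow_pos_of_pos hm r)] at this
  linarith

lemma ball_aux {n : ℕ} {Ω : Set (EuclideanSpace ℝ (Fin n))}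
    {w : EuclideanSpace ℝ (Fin n) → ℝ} (hw : IsWeight Ω w)
    {B : Set (EuclideanSpace ℝ (Fin n))} (hB : B ∈ ballsIn Ω) :
    ∃ P : Measure (EuclideanSpace ℝ (Fin n)), IsProbabilityMeasure P ∧ (∀ᵐ x ∂P, 0 < w x) ∧
      (∀ f : EuclideanSpace ℝ (Fin n) → ℝ, IntegrableOn f B ↔ Integrable f P) ∧
      (∀ f : EuclideanSpace ℝ (Fin n) → ℝ, ⨍ x in B, f x = ∫ x, f x ∂P) := by
  obtain ⟨x, ρ, hρ, rfl, hsub⟩ := hB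
  have h0 : volume (Metric.ball x ρ) ≠ 0 := (Metric.measure_ball_pos volume x hρ).ne'
  have ht : volume (Metric.ball x ρ) ≠ ⊤ := measure_ball_lt_top.ne
  refine ⟨(volume (Metric.ball x ρ))⁻¹ • volume.restrict (Metric.ball x ρ), ⟨?_⟩, ?_, ?_, ?_⟩
  · simp [ENNReal.inv_mul_cancel h0 ht]
  · refine Measure.ae_smul_measure ?_ _
    rw [ae_restrict_iff' measurableSet_ball]
    filter_upwards [hw.2] with y hy hyB
    exact hy (hsub (Metric.ball_subset_ball (by linarith) hyB))
  · intro f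
    rw [integrable_smul_measure (ENNReal.inv_ne_zero.2 ht) (ENNReal.inv_ne_top.2 h0)]
    rfl
  · intro f
    exact setAverage_eq' _ _ _

lemma pMean_coe {n : ℕ} (w : EuclideanSpace ℝ (Fin n) → ℝ) {r : ℝ} (hr : r ≠ 0)
    (B : Set (EuclideanSpace ℝ (Fin n))) :
    pMean w (r : EReal) B = (⨍ x in B, (w x) ^ r) ^ (1 / r) := by
  have : (r : EReal) ≠ 0 := by exact_mod_cast hr
  simp [pMean, this]

lemma pMean_one {n : ℕ} (w : EuclideanSpace ℝ (Fin n) → ℝ)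
    (B : Set (EuclideanSpace ℝ (Fin n))) :
    pMean w 1 B = (⨍ x in B, w x) := by
  have := pMean_coe w one_ne_zero B
  simpa using this

lemma meanFinite_coe {n : ℕ} (w : EuclideanSpace ℝ (Fin n) → ℝ) {r : ℝ} (hr : r ≠ 0)
    (B : Set (EuclideanSpace ℝ (Fin n))) :
    MeanFinite w (r : EReal) B ↔ IntegrableOn (fun x => (w x) ^ r) B := by
  have : (r : EReal) ≠ 0 := by exact_mod_cast hr
  simp [MeanFinite, this]

lemma meanFinite_one {n : ℕ} (w : EuclideanSpace ℝ (Fin n) → ℝ)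
    (B : Set (EuclideanSpace ℝ (Fin n))) :
    MeanFinite w 1 B ↔ IntegrableOn w B := by
  have := meanFinite_coe w one_ne_zero B
  simpa using this

lemma rc_mem {n : ℕ} {Ω : Set (EuclideanSpace ℝ (Fin n))}
    {w : EuclideanSpace ℝ (Fin n) → ℝ} {r s : EReal} (h : InRC Ω w r s) :
    1 ≤ RCconst Ω w r s ∧ MemRC Ω w r s (RCconst Ω w r s) := by
  have hc : IsClosed {C : ℝ | 1 ≤ C ∧ MemRC Ω w r s C} := by
    simp only [MemRC, Set.setOf_and, Set.setOf_forall]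
    refine isClosed_Ici.inter (isClosed_iInter fun B => isClosed_iInter fun _ => ?_)
    exact isClosed_const.inter (isClosed_const.inter
      (isClosed_le continuous_const (continuous_id.mul continuous_const)))
  exact hc.csInf_mem h ⟨1, fun C hC => hC.1⟩

lemma rc_le {n : ℕ} {Ω : Set (EuclideanSpace ℝ (Fin n))}
    {w : EuclideanSpace ℝ (Fin n) → ℝ} {r s : EReal} {C : ℝ} (h1 : 1 ≤ C)
    (h : MemRC Ω w r s C) : RCconst Ω w r s ≤ C :=
  csInf_le ⟨1, fun _ hC => hC.1⟩ ⟨h1, h⟩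

/-- `w ^ s ∈ RC(t/s, 1, C ^ s)` iff `w ∈ RC(t, s, C)`, -/
lemma pow_rc {n : ℕ} {Ω : Set (EuclideanSpace ℝ (Fin n))}
    {w : EuclideanSpace ℝ (Fin n) → ℝ} (hw : IsWeight Ω w) {s t C : ℝ} (hs : 0 < s)
    (ht : t < 0) (hC : 0 ≤ C) :
    MemRC Ω (fun x => w x ^ s) ((t / s : ℝ) : EReal) 1 (C ^ s) ↔
      MemRC Ω w (t : EReal) (s : EReal) C := by
  refine forall₂_congr fun B hB => ?_
  obtain ⟨P, hP, hpos, hI, hA⟩ := ball_aux hw hB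
  have hts : t / s ≠ 0 := (div_neg_of_neg_of_pos ht hs).ne
  rw [meanFinite_coe _ hts, meanFinite_one, meanFinite_coe _ ht.ne, meanFinite_coe _ hs.ne',
    pMean_coe _ hts, pMean_one, pMean_coe _ ht.ne, pMean_coe _ hs.ne']
  simp only [hI, hA]
  have he : (fun x => (w x ^ s) ^ (t / s)) =ᵐ[P] fun x => w x ^ t := by
    filter_upwards [hpos] with x hx
    rw [← Real.rpow_mul hx.le, mul_div_cancel₀ _ hs.ne']
  rw [integrable_congr he, integral_congr_ae he]
  have ha : 0 ≤ ∫ x, w x ^ s ∂P :=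
    integral_nonneg_of_ae (hpos.mono fun x hx => (Real.rpow_pos_of_pos hx _).le)
  have hb : 0 ≤ ∫ x, w x ^ t ∂P :=
    integral_nonneg_of_ae (hpos.mono fun x hx => (Real.rpow_pos_of_pos hx _).le)
  set a := ∫ x, w x ^ s ∂P
  set b := ∫ x, w x ^ t ∂P
  have h1 : C ^ s * b ^ (1 / (t / s)) = (C * b ^ (1 / t)) ^ s := by
    rw [Real.mul_rpow hC (Real.rpow_nonneg hb _), ← Real.rpow_mul hb]
    congr 2
    field_simp
  have h2 : a = (a ^ (1 / s)) ^ s := by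
    rw [← Real.rpow_mul ha, one_div_mul_cancel hs.ne', Real.rpow_one]
  have h3 : a ≤ C ^ s * b ^ (1 / (t / s)) ↔ a ^ (1 / s) ≤ C * b ^ (1 / t) := by
    rw [h1]
    conv_lhs => rw [h2]
    exact Real.rpow_le_rpow_iff (Real.rpow_nonneg ha _)
      (mul_nonneg hC (Real.rpow_nonneg hb _)) hs
  rw [h3]

lemma rc_comp {n : ℕ} {Ω : Set (EuclideanSpace ℝ (Fin n))}
    {w : EuclideanSpace ℝ (Fin n) → ℝ} {r s t : EReal} {C D : ℝ} (hD : 0 ≤ D)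
    (h1 : MemRC Ω w r s C) (h2 : MemRC Ω w s t D) : MemRC Ω w r t (C * D) := by
  intro B hB
  obtain ⟨a1, a2, a3⟩ := h1 B hB
  obtain ⟨b1, b2, b3⟩ := h2 B hB
  refine ⟨a1, b2, ?_⟩
  have := mul_le_mul_of_nonneg_left a3 hD
  linarith

lemma rc_split {n : ℕ} {Ω : Set (EuclideanSpace ℝ (Fin n))}
    {w : EuclideanSpace ℝ (Fin n) → ℝ} (hw : IsWeight Ω w) {s t C : ℝ} (hs : 1 < s)
    (ht : t < 0) (hC : 0 ≤ C) (h : MemRC Ω w (t : EReal) (s : EReal) C) :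
    MemRC Ω w (t : EReal) 1 C ∧ MemRC Ω w 1 (s : EReal) C := by
  have hs0 : 0 < s := by linarith
  rw [MemRC, MemRC, ← forall₂_and]
  intro B hB
  have h := h B hB
  obtain ⟨P, hP, hpos, hI, hA⟩ := ball_aux hw hB
  rw [meanFinite_coe _ ht.ne, meanFinite_coe _ hs0.ne',
    pMean_coe _ ht.ne, pMean_coe _ hs0.ne'] at *
  rw [meanFinite_one, pMean_one]
  simp only [hI, hA] at *
  obtain ⟨h1, h2, h3⟩ := h
  have hwi : Integrable w P := by
    refine Integrable.mono' ((integrable_const (1:ℝ)).add h2) hw.1.aestronglyMeasurable ?_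
    filter_upwards [hpos] with x hx
    rw [Real.norm_of_nonneg hx.le]
    simp only [Pi.add_apply]
    rcases le_total (w x) 1 with h | h
    · have := Real.rpow_pos_of_pos hx s
      linarith
    · have := Real.rpow_le_rpow_of_exponent_le h hs.le
      rw [Real.rpow_one] at this
      linarith
  have hm := int_pos_aux hpos hwi
  have j1 := jensen_aux (Or.inl hs.le) hpos hwi h2
  have j2 := jensen_aux (Or.inr ht) hpos hwi h1
  have k1 : ∫ x, w x ∂P ≤ (∫ x, w x ^ s ∂P) ^ (1 / s) := by
    have := Real.rpow_le_rpow (Real.rpow_nonneg hm.le _) j1 (one_div_pos.2 hs0).le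
    rwa [← Real.rpow_mul hm.le, mul_one_div_cancel hs0.ne', Real.rpow_one] at this
  have k2 : (∫ x, w x ^ t ∂P) ^ (1 / t) ≤ ∫ x, w x ∂P := by
    have := Real.rpow_le_rpow_of_nonpos (Real.rpow_pos_of_pos hm _) j2 (one_div_neg.2 ht).le
    rwa [← Real.rpow_mul hm.le, mul_one_div_cancel ht.ne, Real.rpow_one] at this
  exact ⟨⟨h1, hwi, k1.trans h3⟩, hwi, h2, h3.trans (mul_le_mul_of_nonneg_left k2 hC)⟩

/-- **Corollary 4.7.** For `1 < p, s < ∞` and `q := s(p−1)+1`: if `w ∈ A_p ∩ RH_s`, then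
`w^s ∈ A_q` with `[w^s]_{A_q} ≤ ([w]_{A_p}·[w]_{RH_s})^s`; conversely, if `w^s ∈ A_q`, then
`w ∈ A_p ∩ RH_s` with `max{[w]_{A_p}, [w]_{RH_s}} ≤ [w^s]_{A_q}^{1/s}`. -/
theorem ap_rhs_aq {n : ℕ} (hn : 1 ≤ n)
    {Ω : Set (EuclideanSpace ℝ (Fin n))} (hΩ : IsOpen Ω)
    {w : EuclideanSpace ℝ (Fin n) → ℝ} (hw : IsWeight Ω w)
    {p s q : ℝ} (hp : 1 < p) (hs : 1 < s) (hq : q = s * (p - 1) + 1) :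
    ((InRC Ω w ((1 / (1 - p) : ℝ) : EReal) 1 ∧ InRC Ω w 1 ((s : ℝ) : EReal)) →
      (InRC Ω (fun x => w x ^ s) ((1 / (1 - q) : ℝ) : EReal) 1 ∧
        RCconst Ω (fun x => w x ^ s) ((1 / (1 - q) : ℝ) : EReal) 1
          ≤ (RCconst Ω w ((1 / (1 - p) : ℝ) : EReal) 1 *
              RCconst Ω w 1 ((s : ℝ) : EReal)) ^ s)) ∧
    (InRC Ω (fun x => w x ^ s) ((1 / (1 - q) : ℝ) : EReal) 1 →
      (InRC Ω w ((1 / (1 - p) : ℝ) : EReal) 1 ∧ InRC Ω w 1 ((s : ℝ) : EReal) ∧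
        max (RCconst Ω w ((1 / (1 - p) : ℝ) : EReal) 1) (RCconst Ω w 1 ((s : ℝ) : EReal))
          ≤ (RCconst Ω (fun x => w x ^ s) ((1 / (1 - q) : ℝ) : EReal) 1) ^ (1 / s))) := by
  have hs0 : 0 < s := by linarith
  have ht : 1 / (1 - p) < 0 := one_div_neg.2 (by linarith)
  have hqt : 1 / (1 - q) = 1 / (1 - p) / s := by
    subst hq
    have : 1 - p ≠ 0 := by linarith
    rw [div_div]
    congr 1
    ring
  rw [hqt]
  constructor
  · rintro ⟨h1, h2⟩
    obtain ⟨a1, a2⟩ := rc_mem h1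
    obtain ⟨b1, b2⟩ := rc_mem h2
    have hone := one_le_mul_of_one_le_of_one_le a1 b1
    have h := (pow_rc hw hs0 ht (by linarith)).2 (rc_comp (by linarith) a2 b2)
    have hone' := Real.one_le_rpow hone hs0.le
    exact ⟨⟨_, hone', h⟩, rc_le hone' h⟩
  · intro h
    obtain ⟨a1, a2⟩ := rc_mem h
    set A := RCconst Ω (fun x => w x ^ s) ((1 / (1 - p) / s : ℝ) : EReal) 1
    have hone : 1 ≤ A ^ (1 / s) := Real.one_le_rpow a1 (one_div_pos.2 hs0).le
    have hA : A = (A ^ (1 / s)) ^ s := by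
      rw [← Real.rpow_mul (by linarith), one_div_mul_cancel hs0.ne', Real.rpow_one]
    rw [hA] at a2
    have h2 := (pow_rc hw hs0 ht (by linarith)).1 a2
    obtain ⟨c1, c2⟩ := rc_split hw hs ht (by linarith) h2
    exact ⟨⟨_, hone, c1⟩, ⟨_, hone, c2⟩, max_le (rc_le hone c1) (rc_le hone c2)⟩
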